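/- Let n, m ≥ 2 and let r ∈ ℝ^n, c ∈ ℝ^m have strictly positive entries and equal total sums. For every parameter array t ∈ ℝ^{(n−1)×(m−1)}, the TBP construction is well defined: at every visited position (i,j) the bounds computed from the current budgets satisfy L_{ij} < U_{ij}; and the resulting matrix X = TBP(t) has all entries strictly positive, row sums exactly r, and column sums exactly c, i.e. X lies in the transportation polytope T(r,c). -/

import Mathlib

/-- The logistic sigmoid `σ(x) = 1 / (1 + e^{-x})`. -/
noncomputable def sigmoid (x : ℝ) : ℝ := 1 / (1 + Real.exp (-x))

/-- Entries of the matrix produced by the TBP (North-West corner) construction,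
with `ℕ`-indexed margins `r`, `c` and parameters `t`.  Positions `(i,j)` with
`i < n-1`, `j < m-1` get `L + (U - L) · σ(t i j)` where `L`, `U` are computed from
the current remaining budgets; the last column of each row gets the remaining row
budget, and the last row gets the remaining column budgets. -/
noncomputable def tbpEntry (n m : ℕ) (r c : ℕ → ℝ) (t : ℕ → ℕ → ℝ) : ℕ → ℕ → ℝ
  | i, j =>
    if i = n - 1 then
      -- the last row is filled with the remaining column budgets
      c j - ∑ k ∈ (Finset.range i).attach, tbpEntry n m r c t k.1 j
    else if j = m - 1 then
      -- the last entry of each row is the remaining row budget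
      r i - ∑ k ∈ (Finset.range j).attach, tbpEntry n m r c t i k.1
    else
      let rowB := r i - ∑ k ∈ (Finset.range j).attach, tbpEntry n m r c t i k.1
      let colB := c j - ∑ k ∈ (Finset.range i).attach, tbpEntry n m r c t k.1 j
      let colTail := ∑ k ∈ Finset.Ico (j + 1) m,
        (c k - ∑ l ∈ (Finset.range i).attach, tbpEntry n m r c t l.1 k)
      let rowTail := ∑ k ∈ Finset.Ico (i + 1) n, r k
      let L := max 0 (max (rowB - colTail) (colB - rowTail))
      let U := min rowB colB
      L + (U - L) * sigmoid (t i j)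
termination_by i j => (i, j)
decreasing_by
  all_goals
    first
    | exact Prod.Lex.left _ _ (Finset.mem_range.mp k.2)
    | exact Prod.Lex.right _ (Finset.mem_range.mp k.2)
    | exact Prod.Lex.left _ _ (Finset.mem_range.mp l.2)

/-- Extend a `Fin n`-indexed vector to `ℕ` by zero. -/
def extFin {n : ℕ} (r : Fin n → ℝ) : ℕ → ℝ :=
  fun i => if h : i < n then r ⟨i, h⟩ else 0

/-- Extend a doubly `Fin`-indexed array to `ℕ × ℕ` by zero. -/
def extFin2 {n m : ℕ} (t : Fin n → Fin m → ℝ) : ℕ → ℕ → ℝ :=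
  fun i j => if h : i < n then (if h' : j < m then t ⟨i, h⟩ ⟨j, h'⟩ else 0) else 0

/-- The transportation polytope `T(r,c)`: real `n × m` matrices with nonnegative
entries, row sums `r` and column sums `c`. -/
def transportPolytope (n m : ℕ) (r : Fin n → ℝ) (c : Fin m → ℝ) :
    Set (Matrix (Fin n) (Fin m) ℝ) :=
  {X | (∀ i j, 0 ≤ X i j) ∧ (∀ i, ∑ j, X i j = r i) ∧ (∀ j, ∑ i, X i j = c j)}

/-- The TBP map `Φ : ℝ^{(n-1)×(m-1)} → ℝ^{n×m}`. -/
noncomputable def tbpMap (n m : ℕ) (r : Fin n → ℝ) (c : Fin m → ℝ)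
    (t : Fin (n - 1) → Fin (m - 1) → ℝ) : Matrix (Fin n) (Fin m) ℝ :=
  Matrix.of fun i j => tbpEntry n m (extFin r) (extFin c) (extFin2 t) i j

/-- Current remaining row budget at position `(i,j)` for a matrix `X`:
`r i` minus the entries of row `i` already placed (columns `< j`). -/
noncomputable def rowBudget (r : ℕ → ℝ) (X : ℕ → ℕ → ℝ) (i j : ℕ) : ℝ :=
  r i - ∑ k ∈ Finset.range j, X i k

/-- Current remaining column budget at position `(i,j)` for a matrix `X`:
`c j` minus the entries of column `j` already placed (rows `< i`). -/
noncomputable def colBudget (c : ℕ → ℝ) (X : ℕ → ℕ → ℝ) (i j : ℕ) : ℝ :=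
  c j - ∑ k ∈ Finset.range i, X k j

/-- The lower bound `L_{ij} = max(0, rᵢ − Σ_{k>j} c_k, cⱼ − Σ_{k>i} r_k)` computed
from the current remaining budgets at position `(i,j)`. -/
noncomputable def tbpL (n m : ℕ) (r c : ℕ → ℝ) (X : ℕ → ℕ → ℝ) (i j : ℕ) : ℝ :=
  max 0 (max (rowBudget r X i j - ∑ k ∈ Finset.Ico (j + 1) m, colBudget c X i k)
             (colBudget c X i j - ∑ k ∈ Finset.Ico (i + 1) n, r k))

/-- The upper bound `U_{ij} = min(rᵢ, cⱼ)` computed from the current budgets. -/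
noncomputable def tbpU (r c : ℕ → ℝ) (X : ℕ → ℕ → ℝ) (i j : ℕ) : ℝ :=
  min (rowBudget r X i j) (colBudget c X i j)

theorem sigmoid_pos (x : ℝ) : 0 < sigmoid x := by
  unfold sigmoid
  positivity

theorem sigmoid_lt_one (x : ℝ) : sigmoid x < 1 := by
  unfold sigmoid
  rw [div_lt_one (by positivity)]
  linarith [Real.exp_pos (-x)]

section Entries

variable {n m : ℕ} {r c : ℕ → ℝ} {t : ℕ → ℕ → ℝ}

theorem tbpEntry_last_row (j : ℕ) :
    tbpEntry n m r c t (n - 1) j = colBudget c (tbpEntry n m r c t) (n - 1) j := by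
  rw [tbpEntry, if_pos rfl, colBudget,
    Finset.sum_attach (Finset.range (n - 1)) fun k => tbpEntry n m r c t k j]

theorem tbpEntry_last_col {i : ℕ} (hi : i < n - 1) :
    tbpEntry n m r c t i (m - 1) = rowBudget r (tbpEntry n m r c t) i (m - 1) := by
  rw [tbpEntry, if_neg hi.ne, if_pos rfl, rowBudget,
    Finset.sum_attach (Finset.range (m - 1)) fun k => tbpEntry n m r c t i k]

theorem tbpEntry_interior {i j : ℕ} (hi : i < n - 1) (hj : j < m - 1) :
    tbpEntry n m r c t i j =
      tbpL n m r c (tbpEntry n m r c t) i j +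
        (tbpU r c (tbpEntry n m r c t) i j - tbpL n m r c (tbpEntry n m r c t) i j) *
          sigmoid (t i j) := by
  rw [tbpEntry, if_neg hi.ne, if_neg hj.ne]
  simp only [Finset.sum_attach (Finset.range j) fun k => tbpEntry n m r c t i k,
    fun k => Finset.sum_attach (Finset.range i) fun l => tbpEntry n m r c t l k]
  rfl

theorem tbpEntry_mem_Ioo {i j : ℕ} (hi : i < n - 1) (hj : j < m - 1)
    (h : tbpL n m r c (tbpEntry n m r c t) i j < tbpU r c (tbpEntry n m r c t) i j) :
    tbpEntry n m r c t i j ∈ Set.Ioo (tbpL n m r c (tbpEntry n m r c t) i j)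
      (tbpU r c (tbpEntry n m r c t) i j) := by
  rw [tbpEntry_interior hi hj]
  constructor <;>
    nlinarith [mul_pos (sub_pos.2 h) (sigmoid_pos (t i j)),
      mul_pos (sub_pos.2 h) (sub_pos.2 (sigmoid_lt_one (t i j)))]

end Entries

section Budgets

variable {n m : ℕ} {r c : ℕ → ℝ} {X : ℕ → ℕ → ℝ}

theorem rowBudget_succ (i j : ℕ) : rowBudget r X i (j + 1) = rowBudget r X i j - X i j := by
  simp only [rowBudget, Finset.sum_range_succ]
  ring

theorem colBudget_succ (i j : ℕ) : colBudget c X (i + 1) j = colBudget c X i j - X i j := by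
  simp only [colBudget, Finset.sum_range_succ]
  ring

/-- The bounds are strictly separated as soon as the current budgets are positive, the entries
already placed in the row fit in their columns, and the row budget is smaller than the total of
the remaining column budgets. -/
theorem tbpL_lt_tbpU {i j : ℕ} (hi : i < n - 1) (hj : j < m - 1)
    (hr : ∀ k < n, 0 < r k) (hC : ∀ k < m, 0 < colBudget c X i k)
    (hbal : ∑ k ∈ Finset.Ico i n, r k = ∑ k ∈ Finset.range m, colBudget c X i k)
    (hpos : 0 < rowBudget r X i j)
    (hlt : rowBudget r X i j < ∑ k ∈ Finset.Ico j m, colBudget c X i k)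
    (hfit : ∀ k < j, X i k < colBudget c X i k) :
    tbpL n m r c X i j < tbpU r c X i j := by
  have hrowTail : 0 < ∑ k ∈ Finset.Ico (i + 1) n, r k :=
    Finset.sum_pos (fun k hk => hr k (Finset.mem_Ico.1 hk).2)
      (Finset.nonempty_Ico.2 (by omega))
  have hcolTail : 0 < ∑ k ∈ Finset.Ico (j + 1) m, colBudget c X i k :=
    Finset.sum_pos (fun k hk => hC k (Finset.mem_Ico.1 hk).2)
      (Finset.nonempty_Ico.2 (by omega))
  have hplaced : ∑ k ∈ Finset.range j, X i k ≤ ∑ k ∈ Finset.range j, colBudget c X i k :=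
    Finset.sum_le_sum fun k hk => (hfit k (Finset.mem_range.1 hk)).le
  have hCj := hC j (by omega)
  rw [Finset.sum_eq_sum_Ico_succ_bot (by omega : j < m)] at hlt
  rw [Finset.sum_eq_sum_Ico_succ_bot (by omega : i < n),
    ← Finset.sum_range_add_sum_Ico _ (by omega : j ≤ m),
    Finset.sum_eq_sum_Ico_succ_bot (by omega : j < m)] at hbal
  have hdef : rowBudget r X i j = r i - ∑ k ∈ Finset.range j, X i k := rfl
  simp only [tbpL, tbpU, max_lt_iff, lt_min_iff]
  refine ⟨⟨hpos, ?_, ?_⟩, hCj, ?_, ?_⟩ <;> linarith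

/-- `X` is filled by the TBP rule: interior entries lie strictly between the bounds whenever these
are strictly separated, the last column receives the row budgets and the last row the column
budgets. -/
structure IsTBPFilling (n m : ℕ) (r c : ℕ → ℝ) (X : ℕ → ℕ → ℝ) : Prop where
  interior : ∀ i < n - 1, ∀ j < m - 1, tbpL n m r c X i j < tbpU r c X i j →
    X i j ∈ Set.Ioo (tbpL n m r c X i j) (tbpU r c X i j)
  last_col : ∀ i < n - 1, X i (m - 1) = rowBudget r X i (m - 1)
  last_row : ∀ j, X (n - 1) j = colBudget c X (n - 1) j

theorem isTBPFilling_tbpEntry (n m : ℕ) (r c : ℕ → ℝ) (t : ℕ → ℕ → ℝ) :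
    IsTBPFilling n m r c (tbpEntry n m r c t) where
  interior _ hi _ hj h := tbpEntry_mem_Ioo hi hj h
  last_col _ hi := tbpEntry_last_col hi
  last_row j := tbpEntry_last_row j

namespace IsTBPFilling

theorem row_invariant (hX : IsTBPFilling n m r c X) {i : ℕ} (hi : i < n - 1)
    (hr : ∀ k < n, 0 < r k) (hC : ∀ k < m, 0 < colBudget c X i k)
    (hbal : ∑ k ∈ Finset.Ico i n, r k = ∑ k ∈ Finset.range m, colBudget c X i k)
    {j : ℕ} (hj : j ≤ m - 1) :
    0 < rowBudget r X i j ∧ rowBudget r X i j < ∑ k ∈ Finset.Ico j m, colBudget c X i k ∧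
      ∀ k < j, 0 < X i k ∧ X i k < colBudget c X i k := by
  induction j with
  | zero =>
    have hrowTail : 0 < ∑ k ∈ Finset.Ico (i + 1) n, r k :=
      Finset.sum_pos (fun k hk => hr k (Finset.mem_Ico.1 hk).2)
        (Finset.nonempty_Ico.2 (by omega))
    rw [Finset.sum_eq_sum_Ico_succ_bot (by omega : i < n), Finset.range_eq_Ico] at hbal
    refine ⟨?_, ?_, fun k hk => absurd hk k.not_lt_zero⟩
    · simpa [rowBudget] using hr i (by omega)
    · rw [← hbal]
      simpa [rowBudget] using hrowTail
  | succ j ih =>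
    obtain ⟨hpos, hlt, hfit⟩ := ih (by omega)
    obtain ⟨hl, hu⟩ := hX.interior i hi j (by omega)
      (tbpL_lt_tbpU hi (by omega) hr hC hbal hpos hlt fun k hk => (hfit k hk).2)
    simp only [tbpL, tbpU, max_lt_iff, lt_min_iff] at hl hu
    rw [rowBudget_succ]
    refine ⟨by linarith, by linarith, fun k hk => ?_⟩
    rcases Nat.lt_succ_iff_lt_or_eq.1 hk with hk | rfl
    exacts [hfit k hk, ⟨hl.1, hu.2⟩]

theorem row_entries (hX : IsTBPFilling n m r c X) (hm : 0 < m) {i : ℕ} (hi : i < n - 1)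
    (hr : ∀ k < n, 0 < r k) (hC : ∀ k < m, 0 < colBudget c X i k)
    (hbal : ∑ k ∈ Finset.Ico i n, r k = ∑ k ∈ Finset.range m, colBudget c X i k)
    {j : ℕ} (hj : j < m) : 0 < X i j ∧ X i j < colBudget c X i j := by
  obtain ⟨hpos, hlt, hfit⟩ := hX.row_invariant hi hr hC hbal le_rfl
  rcases lt_or_eq_of_le (Nat.le_sub_one_of_lt hj) with hj | rfl
  · exact hfit j hj
  · rw [← hX.last_col i hi] at hpos hlt
    rw [Finset.sum_eq_sum_Ico_succ_bot (by omega), Nat.sub_add_cancel hm, Finset.Ico_self,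
      Finset.sum_empty, add_zero] at hlt
    exact ⟨hpos, hlt⟩

theorem row_sum_of_lt (hX : IsTBPFilling n m r c X) (hm : 0 < m) {i : ℕ} (hi : i < n - 1) :
    ∑ j ∈ Finset.range m, X i j = r i := by
  obtain ⟨m, rfl⟩ := Nat.exists_eq_succ_of_ne_zero hm.ne'
  have h := hX.last_col i hi
  simp only [Nat.succ_eq_add_one, Nat.add_sub_cancel, rowBudget] at h
  rw [Finset.sum_range_succ, h]
  ring

theorem col_invariant (hX : IsTBPFilling n m r c X) (hm : 0 < m)
    (hr : ∀ k < n, 0 < r k) (hc : ∀ k < m, 0 < c k)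
    (hbal : ∑ k ∈ Finset.range n, r k = ∑ k ∈ Finset.range m, c k)
    {i : ℕ} (hi : i ≤ n - 1) :
    (∀ k < m, 0 < colBudget c X i k) ∧
      ∑ k ∈ Finset.Ico i n, r k = ∑ k ∈ Finset.range m, colBudget c X i k := by
  induction i with
  | zero =>
    rw [← Finset.range_eq_Ico]
    simpa [colBudget] using ⟨hc, hbal⟩
  | succ i ih =>
    obtain ⟨hC, hbal'⟩ := ih (by omega)
    simp only [colBudget_succ, Finset.sum_sub_distrib]
    refine ⟨fun k hk => sub_pos.2 (hX.row_entries hm hi hr hC hbal' hk).2, ?_⟩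
    rw [Finset.sum_eq_sum_Ico_succ_bot (by omega : i < n)] at hbal'
    rw [hX.row_sum_of_lt hm hi]
    linarith

theorem bounds_lt (hX : IsTBPFilling n m r c X)
    (hr : ∀ k < n, 0 < r k) (hc : ∀ k < m, 0 < c k)
    (hbal : ∑ k ∈ Finset.range n, r k = ∑ k ∈ Finset.range m, c k)
    {i j : ℕ} (hi : i < n - 1) (hj : j < m - 1) :
    tbpL n m r c X i j < tbpU r c X i j := by
  obtain ⟨hC, hbal'⟩ := hX.col_invariant (by omega) hr hc hbal hi.le
  obtain ⟨hpos, hlt, hfit⟩ := hX.row_invariant hi hr hC hbal' hj.le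
  exact tbpL_lt_tbpU hi hj hr hC hbal' hpos hlt fun k hk => (hfit k hk).2

theorem pos (hX : IsTBPFilling n m r c X)
    (hr : ∀ k < n, 0 < r k) (hc : ∀ k < m, 0 < c k)
    (hbal : ∑ k ∈ Finset.range n, r k = ∑ k ∈ Finset.range m, c k)
    {i j : ℕ} (hi : i < n) (hj : j < m) : 0 < X i j := by
  obtain ⟨hC, hbal'⟩ := hX.col_invariant (by omega) hr hc hbal (Nat.le_sub_one_of_lt hi)
  rcases lt_or_eq_of_le (Nat.le_sub_one_of_lt hi) with hi | rfl
  · exact (hX.row_entries (by omega) hi hr hC hbal' hj).1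
  · rw [hX.last_row]
    exact hC j hj

theorem row_sum (hX : IsTBPFilling n m r c X) (hm : 0 < m)
    (hr : ∀ k < n, 0 < r k) (hc : ∀ k < m, 0 < c k)
    (hbal : ∑ k ∈ Finset.range n, r k = ∑ k ∈ Finset.range m, c k)
    {i : ℕ} (hi : i < n) : ∑ j ∈ Finset.range m, X i j = r i := by
  rcases lt_or_eq_of_le (Nat.le_sub_one_of_lt hi) with hi' | rfl
  · exact hX.row_sum_of_lt hm hi'
  · have h := (hX.col_invariant hm hr hc hbal le_rfl).2
    rw [Finset.sum_eq_sum_Ico_succ_bot hi, Nat.sub_add_cancel (by omega), Finset.Ico_self,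
      Finset.sum_empty, add_zero] at h
    simp only [hX.last_row]
    exact h.symm

theorem col_sum (hX : IsTBPFilling n m r c X) (hn : 0 < n) (j : ℕ) :
    ∑ i ∈ Finset.range n, X i j = c j := by
  obtain ⟨n, rfl⟩ := Nat.exists_eq_succ_of_ne_zero hn.ne'
  have h := hX.last_row j
  simp only [Nat.succ_eq_add_one, Nat.add_sub_cancel, colBudget] at h
  rw [Finset.sum_range_succ, h]
  ring

end IsTBPFilling

end Budgets

theorem extFin_val {n : ℕ} (r : Fin n → ℝ) (i : Fin n) : extFin r i = r i := by
  simp [extFin]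

theorem extFin_pos {n : ℕ} {r : Fin n → ℝ} (hr : ∀ i, 0 < r i) : ∀ k < n, 0 < extFin r k :=
  fun k hk => by simpa [extFin, hk] using hr ⟨k, hk⟩

theorem sum_range_extFin {n : ℕ} (r : Fin n → ℝ) :
    ∑ k ∈ Finset.range n, extFin r k = ∑ i, r i := by
  simp only [Finset.sum_range, extFin_val]

/-- For `n, m ≥ 2`, strictly positive margins with equal sums, and any
parameter array `t`, the TBP construction is well defined: at every visited position
`(i,j)` (i.e. `i < n-1`, `j < m-1`, `0`-based) the bounds satisfy `L_{ij} < U_{ij}`, and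
the resulting matrix has strictly positive entries, row sums `r` and column sums `c`. -/
theorem tbp_well_defined (n m : ℕ) (hn : 2 ≤ n) (hm : 2 ≤ m)
    (r : Fin n → ℝ) (c : Fin m → ℝ)
    (hr : ∀ i, 0 < r i) (hc : ∀ j, 0 < c j)
    (hbal : ∑ i, r i = ∑ j, c j)
    (t : Fin (n - 1) → Fin (m - 1) → ℝ) :
    (∀ i < n - 1, ∀ j < m - 1,
        tbpL n m (extFin r) (extFin c)
            (tbpEntry n m (extFin r) (extFin c) (extFin2 t)) i j <
          tbpU (extFin r) (extFin c)
            (tbpEntry n m (extFin r) (extFin c) (extFin2 t)) i j) ∧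
    (∀ i j, 0 < tbpMap n m r c t i j) ∧
    tbpMap n m r c t ∈ transportPolytope n m r c := by
  have hX := isTBPFilling_tbpEntry n m (extFin r) (extFin c) (extFin2 t)
  have hr' := extFin_pos hr
  have hc' := extFin_pos hc
  have hbal' : ∑ k ∈ Finset.range n, extFin r k = ∑ k ∈ Finset.range m, extFin c k := by
    rw [sum_range_extFin, sum_range_extFin, hbal]
  have hpos : ∀ i j, 0 < tbpMap n m r c t i j := fun i j => hX.pos hr' hc' hbal' i.2 j.2
  refine ⟨fun i hi j hj => hX.bounds_lt hr' hc' hbal' hi hj, hpos,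
    fun i j => (hpos i j).le, fun i => ?_, fun j => ?_⟩
  · rw [← extFin_val r i, ← hX.row_sum (by omega) hr' hc' hbal' i.2, Finset.sum_range]
    rfl
  · rw [← extFin_val c j, ← hX.col_sum (by omega) j, Finset.sum_range]
    rfl
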